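/- In a B-ESG grammar, applying any production to a non-terminal of an ESG-form yields an ESG-form; hence, by induction on the length of derivations, any derivation in the B-edNCE part of a B-ESG grammar starting from an ESG-form and eliminating all non-terminals produces an encoded string graph. In particular, since the initial graph S is an ESG-form, every graph derived in G with no non-terminals is an encoded string graph. -/

import Mathlib

set_option linter.dupNamespace false

namespace BESG

/-- Vertex labels: terminal node-vertex labels `NL`, terminal wire-vertex labels `WL`,
or non-terminal labels `NT`. -/
abbrev VLab (NL WL NT : Type) := (NL ⊕ WL) ⊕ NT

def isNodeL {NL WL NT : Type} : VLab NL WL NT → Bool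
  | .inl (.inl _) => true
  | _ => false

def isWireL {NL WL NT : Type} : VLab NL WL NT → Bool
  | .inl (.inr _) => true
  | _ => false

def isNTL {NL WL NT : Type} : VLab NL WL NT → Bool
  | .inr _ => true
  | _ => false

/-- A finite directed labelled graph with vertices drawn from `ℕ`, no self-loops,
and parallel edges allowed only with distinct edge labels. -/
structure Graph (VL Ga : Type) where
  verts : Finset ℕ
  edges : Finset (ℕ × Ga × ℕ)
  lab : ℕ → VL
  edge_src : ∀ e ∈ edges, e.1 ∈ verts
  edge_tgt : ∀ e ∈ edges, e.2.2 ∈ verts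
  no_loop : ∀ e ∈ edges, e.1 ≠ e.2.2

variable {NL WL NT EL : Type}

/-- Graphs over the label alphabet of a string-graph grammar. -/
abbrev SG (NL WL NT EL : Type) := Graph (VLab NL WL NT) EL

def inDeg (H : SG NL WL NT EL) (v : ℕ) : ℕ := (H.edges.filter fun e => e.2.2 = v).card

def outDeg (H : SG NL WL NT EL) (v : ℕ) : ℕ := (H.edges.filter fun e => e.1 = v).card

/-- The graph contains no non-terminal vertices. -/
def NoNT (H : SG NL WL NT EL) : Prop := ∀ v ∈ H.verts, ¬ isNTL (H.lab v)

/-- A string graph: no non-terminals, no edges between node-vertices, and every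
wire-vertex has in-degree and out-degree at most one. -/
def IsStringGraph (H : SG NL WL NT EL) : Prop :=
  NoNT H ∧
  (∀ e ∈ H.edges, ¬ (isNodeL (H.lab e.1) ∧ isNodeL (H.lab e.2.2))) ∧
  (∀ v ∈ H.verts, isWireL (H.lab v) → inDeg H v ≤ 1 ∧ outDeg H v ≤ 1)

/-- An encoded string graph: like a string graph, but edges between node-vertices
are allowed exactly when they carry an encoding label from `enc`. -/
def IsEncodedSG (enc : Finset EL) (H : SG NL WL NT EL) : Prop :=
  NoNT H ∧
  (∀ e ∈ H.edges, ((isNodeL (H.lab e.1) ∧ isNodeL (H.lab e.2.2)) ↔ e.2.1 ∈ enc)) ∧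
  (∀ v ∈ H.verts, isWireL (H.lab v) → inDeg H v ≤ 1 ∧ outDeg H v ≤ 1)

/-- Inputs: wire-vertices with no incoming edge. -/
def Inputs (H : SG NL WL NT EL) : Finset ℕ :=
  H.verts.filter fun v => isWireL (H.lab v) = true ∧ inDeg H v = 0

/-- Outputs: wire-vertices with no outgoing edge. -/
def Outputs (H : SG NL WL NT EL) : Finset ℕ :=
  H.verts.filter fun v => isWireL (H.lab v) = true ∧ outDeg H v = 0

def Boundary (H : SG NL WL NT EL) : Finset ℕ := Inputs H ∪ Outputs H

def NTVerts (H : SG NL WL NT EL) : Finset ℕ :=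
  H.verts.filter fun v => isNTL (H.lab v) = true

def wireVertexCount (H : SG NL WL NT EL) : ℕ :=
  (H.verts.filter fun v => isWireL (H.lab v) = true).card

def Adj (H : SG NL WL NT EL) (u w : ℕ) : Prop :=
  ∃ γ, (u, γ, w) ∈ H.edges ∨ (w, γ, u) ∈ H.edges

def ConnectedG (H : SG NL WL NT EL) : Prop :=
  ∀ u ∈ H.verts, ∀ w ∈ H.verts, Relation.ReflTransGen (Adj H) u w

/-- A wire: a maximal connected subgraph consisting of wire-vertices only and
containing at least one edge, given by its (finite) set `s` of vertices. -/
def IsWireSet (H : SG NL WL NT EL) (s : Finset ℕ) : Prop :=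
  s ⊆ H.verts ∧ (∀ v ∈ s, isWireL (H.lab v)) ∧
  (∃ e ∈ H.edges, e.1 ∈ s ∧ e.2.2 ∈ s) ∧
  (∀ u ∈ s, ∀ w ∈ s, Relation.ReflTransGen (fun a b => Adj H a b ∧ a ∈ s ∧ b ∈ s) u w) ∧
  (∀ u ∈ s, ∀ w, isWireL (H.lab w) → w ∈ H.verts → Adj H u w → w ∈ s)

/-- A bare wire: a wire not connected to anything outside itself (in particular to
no node-vertex) and which is a chain rather than a circle. -/
def HasBareWire (D : SG NL WL NT EL) : Prop :=
  ∃ s, IsWireSet D s ∧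
    (∀ e ∈ D.edges, ¬ (e.1 ∈ s ∧ e.2.2 ∉ s) ∧ ¬ (e.2.2 ∈ s ∧ e.1 ∉ s)) ∧
    (∃ v ∈ s, inDeg D v = 0 ∨ outDeg D v = 0)

/-- A connection instruction `(σ, β/γ, x, d)`. -/
structure ConnInstr (NL WL NT EL : Type) where
  src : VLab NL WL NT
  oldLab : EL
  newLab : EL
  target : ℕ
  dirIn : Bool

/-- A production `X → (D, C)` of an edNCE grammar. -/
structure Production (NL WL NT EL : Type) where
  lhs : NT
  body : SG NL WL NT EL
  conn : List (ConnInstr NL WL NT EL)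

/-- An edNCE grammar (with all vertex labels in `NL ⊕ WL` terminal and all edge
labels final, as assumed throughout the paper). -/
structure Grammar (NL WL NT EL : Type) where
  prods : List (Production NL WL NT EL)
  start : NT

/-- The initial graph: a single vertex labelled by the initial non-terminal. -/
def startGraph (S : NT) : SG NL WL NT EL where
  verts := {0}
  edges := ∅
  lab := fun _ => .inr S
  edge_src := by simp
  edge_tgt := by simp
  no_loop := by simp

/-- One derivation step: the non-terminal vertex `v` is replaced by (a fresh copy,
via the injection `f`, of) the body of the `i`-th production, with bridge edges
installed according to the connection instructions. -/
def StepWith (G : Grammar NL WL NT EL) (H : SG NL WL NT EL) (v i : ℕ) (f : ℕ → ℕ)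
    (H' : SG NL WL NT EL) : Prop :=
  ∃ p, G.prods[i]? = some p ∧ v ∈ H.verts ∧ H.lab v = .inr p.lhs ∧
    Set.InjOn f (p.body.verts : Set ℕ) ∧ (∀ w ∈ p.body.verts, f w ∉ H.verts) ∧
    H'.verts = H.verts.erase v ∪ p.body.verts.image f ∧
    (∀ w ∈ H.verts.erase v, H'.lab w = H.lab w) ∧
    (∀ w ∈ p.body.verts, H'.lab (f w) = p.body.lab w) ∧
    (∀ e, e ∈ H'.edges ↔
      (e ∈ H.edges ∧ e.1 ≠ v ∧ e.2.2 ≠ v) ∨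
      (∃ d ∈ p.body.edges, e = (f d.1, d.2.1, f d.2.2)) ∨
      (∃ c ∈ p.conn, c.target ∈ p.body.verts ∧
        ((c.dirIn = true ∧ ∃ w, (w, c.oldLab, v) ∈ H.edges ∧ H.lab w = c.src ∧
            e = (w, c.newLab, f c.target)) ∨
         (c.dirIn = false ∧ ∃ w, (v, c.oldLab, w) ∈ H.edges ∧ H.lab w = c.src ∧
            e = (f c.target, c.newLab, w)))))

/-- A derivation recording its sequence of steps `(v, i, f)`. -/
inductive DerivesSeq (G : Grammar NL WL NT EL) :
    SG NL WL NT EL → List (ℕ × ℕ × (ℕ → ℕ)) → SG NL WL NT EL → Prop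
  | refl (H : SG NL WL NT EL) : DerivesSeq G H [] H
  | step {H K H' : SG NL WL NT EL} {v i : ℕ} {f : ℕ → ℕ} {steps} :
      StepWith G H v i f K → DerivesSeq G K steps H' →
      DerivesSeq G H ((v, i, f) :: steps) H'

def Deriv (G : Grammar NL WL NT EL) (H H' : SG NL WL NT EL) : Prop :=
  ∃ steps, DerivesSeq G H steps H'

/-- A decoding rule: a replacement graph `rhs` with two distinguished glueing
vertices `a` and `b` (the invariant node-vertices of the DPO rule). -/
structure DecRule (NL WL NT EL : Type) where
  rhs : SG NL WL NT EL
  a : ℕ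
  b : ℕ

def NoEncEdges (enc : Finset EL) (H : SG NL WL NT EL) : Prop :=
  ∀ e ∈ H.edges, e.2.1 ∉ enc

/-- A decoding system: one DPO rule per triple `(α, N₁, N₂)` with `α ∈ enc`, whose
RHS is a connected string graph with no inputs, no outputs and no encoding labels,
glued along its two distinguished node-vertices labelled `N₁` and `N₂`. -/
def IsDecodingSystem (enc : Finset EL) (T : EL → NL → NL → DecRule NL WL NT EL) : Prop :=
  ∀ α ∈ enc, ∀ N₁ N₂ : NL,
    IsStringGraph (T α N₁ N₂).rhs ∧ ConnectedG (T α N₁ N₂).rhs ∧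
    (T α N₁ N₂).a ∈ (T α N₁ N₂).rhs.verts ∧ (T α N₁ N₂).b ∈ (T α N₁ N₂).rhs.verts ∧
    (T α N₁ N₂).a ≠ (T α N₁ N₂).b ∧
    (T α N₁ N₂).rhs.lab (T α N₁ N₂).a = .inl (.inl N₁) ∧
    (T α N₁ N₂).rhs.lab (T α N₁ N₂).b = .inl (.inl N₂) ∧
    Inputs (T α N₁ N₂).rhs = ∅ ∧ Outputs (T α N₁ N₂).rhs = ∅ ∧
    NoEncEdges enc (T α N₁ N₂).rhs

/-- One decoding step: an encoding edge `(u, α, w)` between node-vertices is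
replaced (DPO-style) by a fresh copy of the corresponding RHS, glued at `u, w`. -/
def DecStep (enc : Finset EL) (T : EL → NL → NL → DecRule NL WL NT EL)
    (H H' : SG NL WL NT EL) : Prop :=
  ∃ u α w N₁ N₂, ∃ f : ℕ → ℕ,
    (u, α, w) ∈ H.edges ∧ α ∈ enc ∧
    H.lab u = .inl (.inl N₁) ∧ H.lab w = .inl (.inl N₂) ∧
    f (T α N₁ N₂).a = u ∧ f (T α N₁ N₂).b = w ∧
    Set.InjOn f ((T α N₁ N₂).rhs.verts : Set ℕ) ∧
    (∀ x ∈ (T α N₁ N₂).rhs.verts, x ≠ (T α N₁ N₂).a → x ≠ (T α N₁ N₂).b → f x ∉ H.verts) ∧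
    H'.verts = H.verts ∪ (T α N₁ N₂).rhs.verts.image f ∧
    (∀ x ∈ H.verts, H'.lab x = H.lab x) ∧
    (∀ x ∈ (T α N₁ N₂).rhs.verts, H'.lab (f x) = (T α N₁ N₂).rhs.lab x) ∧
    (∀ e, e ∈ H'.edges ↔
      (e ∈ H.edges ∧ e ≠ (u, α, w)) ∨
      ∃ d ∈ (T α N₁ N₂).rhs.edges, e = (f d.1, d.2.1, f d.2.2))

/-- A B-ESG grammar datum: a grammar together with encoding symbols and a
decoding system. -/
structure BESG (NL WL NT EL : Type) where
  G : Grammar NL WL NT EL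
  enc : Finset EL
  T : EL → NL → NL → DecRule NL WL NT EL

/-- The boundary (B-edNCE) conditions and conditions N1, N2, W1–W4 for a single
production, relative to the whole grammar (for W4). -/
def CondsNW (enc : Finset EL) (G : Grammar NL WL NT EL) (p : Production NL WL NT EL) : Prop :=
  -- B-edNCE: no adjacent non-terminals in the body
  (∀ e ∈ p.body.edges, ¬ (isNTL (p.body.lab e.1) ∧ isNTL (p.body.lab e.2.2))) ∧
  -- B-edNCE: no connection instruction with non-terminal source label
  (∀ c ∈ p.conn, ¬ isNTL c.src) ∧
  -- N1: an edge carries an encoding label iff it connects two node-vertices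
  (∀ e ∈ p.body.edges,
    (e.2.1 ∈ enc ↔ (isNodeL (p.body.lab e.1) ∧ isNodeL (p.body.lab e.2.2)))) ∧
  -- N2: instructions targeting a node-vertex from a node label produce encoding labels
  (∀ c ∈ p.conn, isNodeL c.src → c.target ∈ p.body.verts →
    isNodeL (p.body.lab c.target) → c.newLab ∈ enc) ∧
  -- W1: wire-vertices in the body have in- and out-degree at most one
  (∀ v ∈ p.body.verts, isWireL (p.body.lab v) → inDeg p.body v ≤ 1 ∧ outDeg p.body v ≤ 1) ∧
  -- W2: no connection instruction targets a wire-vertex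
  (∀ c ∈ p.conn, c.target ∈ p.body.verts → ¬ isWireL (p.body.lab c.target)) ∧
  -- W3: at most one instruction per wire label, edge label and direction, non-encoding
  (∀ c ∈ p.conn, ∀ c' ∈ p.conn, isWireL c.src → c.src = c'.src →
    c.oldLab = c'.oldLab → c.dirIn = c'.dirIn → c = c') ∧
  (∀ c ∈ p.conn, isWireL c.src → c.newLab ∉ enc) ∧
  -- W4: wires attached (directly or by instruction) to a non-terminal are matched
  -- by an instruction in every production for that non-terminal
  (∀ y ∈ p.body.verts, ∀ Y : NT, p.body.lab y = .inr Y →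
    ∀ (Wl : WL) (β : EL) (d : Bool),
      ((d = true ∧ ∃ x ∈ p.body.verts, p.body.lab x = .inl (.inr Wl) ∧ (x, β, y) ∈ p.body.edges) ∨
       (d = false ∧ ∃ x ∈ p.body.verts, p.body.lab x = .inl (.inr Wl) ∧ (y, β, x) ∈ p.body.edges) ∨
       (∃ c ∈ p.conn, c.src = .inl (.inr Wl) ∧ c.newLab = β ∧ c.target = y ∧ c.dirIn = d)) →
      ∀ p' ∈ G.prods, p'.lhs = Y →
        ∃ c ∈ p'.conn, c.src = .inl (.inr Wl) ∧ c.oldLab = β ∧ c.dirIn = d)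

/-- `B` is a B-ESG grammar. -/
def IsBESG (B : BESG NL WL NT EL) : Prop :=
  IsDecodingSystem B.enc B.T ∧ ∀ p ∈ B.G.prods, CondsNW B.enc B.G p

/-- A concrete derivation `S ⟹* H₁ ⟹*_T F` of the B-ESG grammar `B`. -/
def ConcreteDeriv (B : BESG NL WL NT EL) (F : SG NL WL NT EL) : Prop :=
  ∃ H₁, Deriv B.G (startGraph B.G.start) H₁ ∧ NoNT H₁ ∧
    Relation.ReflTransGen (DecStep B.enc B.T) H₁ F ∧ NoEncEdges B.enc F

/-- The language of a B-ESG grammar. -/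
def Lang (B : BESG NL WL NT EL) : Set (SG NL WL NT EL) := {F | ConcreteDeriv B F}

/-- Graph isomorphism. -/
def Iso (H K : SG NL WL NT EL) : Prop :=
  ∃ φ : ℕ → ℕ, Set.BijOn φ (H.verts : Set ℕ) (K.verts : Set ℕ) ∧
    (∀ v ∈ H.verts, K.lab (φ v) = H.lab v) ∧
    (∀ e ∈ H.edges, (φ e.1, e.2.1, φ e.2.2) ∈ K.edges) ∧
    (∀ e ∈ K.edges, ∃ d ∈ H.edges, e = (φ d.1, d.2.1, φ d.2.2))

/-- Merging two adjacent wire-vertices `u, v` (of the same wire label) into `u`. -/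
def MergeStep (H H' : SG NL WL NT EL) : Prop :=
  ∃ u β v, (u, β, v) ∈ H.edges ∧ u ∈ H.verts ∧ v ∈ H.verts ∧
    isWireL (H.lab u) ∧ isWireL (H.lab v) ∧ H.lab u = H.lab v ∧
    (∀ γ, (v, γ, u) ∉ H.edges) ∧
    H'.verts = H.verts.erase v ∧
    (∀ x ∈ H.verts.erase v, H'.lab x = H.lab x) ∧
    (∀ e, e ∈ H'.edges ↔
      (e ∈ H.edges ∧ e.1 ≠ v ∧ e.2.2 ≠ v) ∨
      (∃ γ x, (v, γ, x) ∈ H.edges ∧ e = (u, γ, x)))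

/-- Wire-homeomorphism: the equivalence closure of merging/splitting. -/
def WireHomeo (H H' : SG NL WL NT EL) : Prop :=
  Relation.EqvGen (MergeStep (NL := NL) (WL := WL) (NT := NT) (EL := EL)) H H'

/-- A matching of `L` into `H`: an injective label-preserving homomorphism such
that the only edges incident to the image of `L` are incident to the image of
the boundary of `L`. -/
def IsMatching (L : SG NL WL NT EL) (m : ℕ → ℕ) (H : SG NL WL NT EL) : Prop :=
  Set.InjOn m (L.verts : Set ℕ) ∧ (∀ v ∈ L.verts, m v ∈ H.verts) ∧
  (∀ v ∈ L.verts, H.lab (m v) = L.lab v) ∧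
  (∀ e ∈ L.edges, (m e.1, e.2.1, m e.2.2) ∈ H.edges) ∧
  (∀ e ∈ H.edges,
    (e.1 ∈ L.verts.image m ∧ e.2.2 ∉ L.verts.image m → e.1 ∈ (Boundary L).image m) ∧
    (e.2.2 ∈ L.verts.image m ∧ e.1 ∉ L.verts.image m → e.2.2 ∈ (Boundary L).image m))

/-- `L` matches onto `H` up to wire-homeomorphism. -/
def MatchesModHomeo (L H : SG NL WL NT EL) : Prop :=
  ∃ Ht m, WireHomeo H Ht ∧ IsMatching L m Ht

/-- A string graph rewrite rule `L ← B → R`, where the common boundary is shared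
by name. -/
def IsSGRule (L R : SG NL WL NT EL) : Prop :=
  IsStringGraph L ∧ IsStringGraph R ∧
  Inputs L = Inputs R ∧ Outputs L = Outputs R ∧
  (∀ v ∈ Boundary L, R.lab v = L.lab v)

/-- Double-pushout rewriting of `G` at the matching `m` of `Lr`, glueing in a
fresh copy (via `g`) of `Rr` along the boundary. -/
def RewriteWith (Lr Rr : SG NL WL NT EL) (G : SG NL WL NT EL) (m g : ℕ → ℕ)
    (G' : SG NL WL NT EL) : Prop :=
  IsMatching Lr m G ∧
  (∀ v ∈ Boundary Lr, g v = m v) ∧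
  Set.InjOn g (Rr.verts : Set ℕ) ∧
  (∀ v ∈ Rr.verts, v ∉ Boundary Lr → g v ∉ G.verts) ∧
  G'.verts = (G.verts \ (Lr.verts \ Boundary Lr).image m) ∪ Rr.verts.image g ∧
  (∀ v ∈ G.verts, v ∉ (Lr.verts \ Boundary Lr).image m → G'.lab v = G.lab v) ∧
  (∀ v ∈ Rr.verts, G'.lab (g v) = Rr.lab v) ∧
  (∀ e, e ∈ G'.edges ↔
    (e ∈ G.edges ∧ (∀ d ∈ Lr.edges, e ≠ (m d.1, d.2.1, m d.2.2)) ∧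
      e.1 ∉ (Lr.verts \ Boundary Lr).image m ∧ e.2.2 ∉ (Lr.verts \ Boundary Lr).image m) ∨
    (∃ d ∈ Rr.edges, e = (g d.1, d.2.1, g d.2.2)))

/-- Rewriting `G` to `G'` with the rule `Lr ← B → Rr` at some matching. -/
def RewriteRel (Lr Rr : SG NL WL NT EL) (G G' : SG NL WL NT EL) : Prop :=
  ∃ m g, RewriteWith Lr Rr G m g G'

/-- Rewriting modulo wire-homeomorphism. -/
def SGRewrite (Lr Rr : SG NL WL NT EL) (G G' : SG NL WL NT EL) : Prop :=
  ∃ Gt, WireHomeo G Gt ∧ RewriteRel Lr Rr Gt G'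

/-- `n`-fold composition of a relation. -/
def RelPow {α : Type*} (r : α → α → Prop) : ℕ → α → α → Prop
  | 0, a, b => a = b
  | n + 1, a, b => ∃ c, r a c ∧ RelPow r n c b

/-- A final subgraph of a production body: a string-graph subgraph not adjacent to
any non-terminal and whose vertices occur in no connection instruction. -/
def IsFinalSub (p : Production NL WL NT EL) (s : Finset ℕ) : Prop :=
  s ⊆ p.body.verts ∧
  (∀ v ∈ s, ¬ isNTL (p.body.lab v)) ∧
  (∀ e ∈ p.body.edges, e.1 ∈ s → e.2.2 ∈ s →
    ¬ (isNodeL (p.body.lab e.1) ∧ isNodeL (p.body.lab e.2.2))) ∧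
  (∀ e ∈ p.body.edges, (e.1 ∈ s → ¬ isNTL (p.body.lab e.2.2)) ∧
    (e.2.2 ∈ s → ¬ isNTL (p.body.lab e.1))) ∧
  (∀ c ∈ p.conn, c.target ∉ s)

/-- A B-ESG transformation step: production `i` of `B` has its body rewritten by
the string graph rewrite rule `Lr ← B → Rr` at a matching into a final subgraph;
everything else is unchanged. -/
def TransformStepAt (B : BESG NL WL NT EL) (Lr Rr : SG NL WL NT EL) (i : ℕ)
    (B' : BESG NL WL NT EL) : Prop :=
  B'.enc = B.enc ∧ B'.T = B.T ∧ B'.G.start = B.G.start ∧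
  ∃ p p', B.G.prods[i]? = some p ∧
    B'.G.prods = B.G.prods.set i p' ∧
    p'.lhs = p.lhs ∧ p'.conn = p.conn ∧
    ∃ s m g, IsFinalSub p s ∧ (∀ v ∈ Lr.verts, m v ∈ s) ∧
      RewriteWith Lr Rr p.body m g p'.body

/-- A B-ESG rewrite pattern `(B₁, B₂)`: same decoding system, same initial
non-terminal, and a production-wise correspondence satisfying NT and IO (with
corresponding non-terminals, inputs and outputs identified by sharing names). -/
def IsRewritePattern (B₁ B₂ : BESG NL WL NT EL) : Prop :=
  IsBESG B₁ ∧ IsBESG B₂ ∧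
  B₁.enc = B₂.enc ∧ B₁.T = B₂.T ∧ B₁.G.start = B₂.G.start ∧
  B₁.G.prods.length = B₂.G.prods.length ∧
  ∀ (i : ℕ) (p₁ p₂ : Production NL WL NT EL),
    B₁.G.prods[i]? = some p₁ → B₂.G.prods[i]? = some p₂ →
    p₁.lhs = p₂.lhs ∧
    NTVerts p₁.body = NTVerts p₂.body ∧
    (∀ v ∈ NTVerts p₁.body, p₁.body.lab v = p₂.body.lab v) ∧
    Inputs p₁.body = Inputs p₂.body ∧ Outputs p₁.body = Outputs p₂.body

/-- A pattern instantiation: identical derivation sequences in `B₁` and `B₂`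
(applying corresponding productions at corresponding non-terminals), followed by
decoding, producing the rule `F ← B → F'`. -/
def Instantiates (B₁ B₂ : BESG NL WL NT EL) (F F' : SG NL WL NT EL) : Prop :=
  ∃ steps H₁ H₁',
    DerivesSeq B₁.G (startGraph B₁.G.start) steps H₁ ∧ NoNT H₁ ∧
    Relation.ReflTransGen (DecStep B₁.enc B₁.T) H₁ F ∧ NoEncEdges B₁.enc F ∧
    DerivesSeq B₂.G (startGraph B₂.G.start) steps H₁' ∧ NoNT H₁' ∧
    Relation.ReflTransGen (DecStep B₂.enc B₂.T) H₁' F' ∧ NoEncEdges B₂.enc F'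

/-- Match-exhaustive B-ESG grammar (Definition: bare-wire productions are
boundedly expandable; no isolated wire-vertices; no empty productions; no
single-non-terminal productions). -/
def MatchExhaustive (B : BESG NL WL NT EL) : Prop :=
  (∀ i p, B.G.prods[i]? = some p → HasBareWire p.body →
    ∃ N, ∀ steps K, DerivesSeq B.G (startGraph B.G.start) steps K →
      steps.countP (fun st => st.2.1 == i) ≤ N) ∧
  (∀ p ∈ B.G.prods, ∀ v ∈ p.body.verts, isWireL (p.body.lab v) →
    0 < inDeg p.body v + outDeg p.body v) ∧
  (∀ p ∈ B.G.prods, p.body.verts.Nonempty) ∧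
  (∀ p ∈ B.G.prods, ¬ ∃ v, p.body.verts = {v} ∧ isNTL (p.body.lab v))

/-- ESG-form: an encoded string graph possibly with extra non-terminals, attached
so that node-node edges are encoding edges, encoding edges avoid wire-vertices,
and wire-vertices keep in-degree and out-degree at most one. -/
def IsESGForm (enc : Finset EL) (H : SG NL WL NT EL) : Prop :=
  (∀ e ∈ H.edges, isNodeL (H.lab e.1) → isNodeL (H.lab e.2.2) → e.2.1 ∈ enc) ∧
  (∀ e ∈ H.edges, e.2.1 ∈ enc → ¬ isWireL (H.lab e.1) ∧ ¬ isWireL (H.lab e.2.2)) ∧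
  (∀ v ∈ H.verts, isWireL (H.lab v) → inDeg H v ≤ 1 ∧ outDeg H v ≤ 1)


theorem inDeg_le_one_iff {H : SG NL WL NT EL} {v : ℕ} :
    inDeg H v ≤ 1 ↔ ∀ e ∈ H.edges, ∀ e' ∈ H.edges, e.2.2 = v → e'.2.2 = v → e = e' := by
  unfold inDeg
  rw [Finset.card_le_one]
  simp only [Finset.mem_filter]
  constructor
  · intro h e he e' he' hv hv'
    exact h e ⟨he, hv⟩ e' ⟨he', hv'⟩
  · intro h e he e' he'
    exact h e he.1 e' he'.1 he.2 he'.2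

theorem outDeg_le_one_iff {H : SG NL WL NT EL} {v : ℕ} :
    outDeg H v ≤ 1 ↔ ∀ e ∈ H.edges, ∀ e' ∈ H.edges, e.1 = v → e'.1 = v → e = e' := by
  unfold outDeg
  rw [Finset.card_le_one]
  simp only [Finset.mem_filter]
  constructor
  · intro h e he e' he' hv hv'
    exact h e ⟨he, hv⟩ e' ⟨he', hv'⟩
  · intro h e he e' he'
    exact h e he.1 e' he'.1 he.2 he'.2

/-- Applying a production that satisfies the boundary and N/W conditions to an ESG-form
yields an ESG-form. -/
theorem IsESGForm.stepWith {enc : Finset EL} {G : Grammar NL WL NT EL}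
    (hG : ∀ p ∈ G.prods, CondsNW enc G p) {H H' : SG NL WL NT EL} {v i : ℕ} {f : ℕ → ℕ}
    (hH : IsESGForm enc H) (hs : StepWith G H v i f H') : IsESGForm enc H' := by
  obtain ⟨p, hp, -, -, hinj, hfresh, hverts, hlab, hlabf, hedges⟩ := hs
  obtain ⟨-, -, N1, N2, W1, W2, W3, W3', -⟩ := hG p (List.mem_of_getElem? hp)
  obtain ⟨hnode, henc, hwire⟩ := hH
  have hlab_old : ∀ w ∈ H.verts, w ≠ v → H'.lab w = H.lab w := fun w hw hwv =>
    hlab w (Finset.mem_erase.2 ⟨hwv, hw⟩)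
  refine ⟨?_, ?_, ?_⟩
  · intro e he h1 h2
    rcases (hedges e).1 he with ⟨heH, hs, ht⟩ | ⟨d, hd, rfl⟩ |
      ⟨c, hc, hct, ⟨-, w, hw, hsrc, rfl⟩ | ⟨-, w, hw, hsrc, rfl⟩⟩
    · rw [hlab_old _ (H.edge_src e heH) hs] at h1
      rw [hlab_old _ (H.edge_tgt e heH) ht] at h2
      exact hnode e heH h1 h2
    · rw [hlabf _ (p.body.edge_src d hd)] at h1
      rw [hlabf _ (p.body.edge_tgt d hd)] at h2
      exact (N1 d hd).2 ⟨h1, h2⟩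
    · rw [hlab_old w (H.edge_src _ hw) (H.no_loop _ hw), hsrc] at h1
      rw [hlabf _ hct] at h2
      exact N2 c hc h1 hct h2
    · rw [hlab_old w (H.edge_tgt _ hw) (H.no_loop _ hw).symm, hsrc] at h2
      rw [hlabf _ hct] at h1
      exact N2 c hc h2 hct h1
  · intro e he hα
    rcases (hedges e).1 he with ⟨heH, hs, ht⟩ | ⟨d, hd, rfl⟩ |
      ⟨c, hc, hct, ⟨-, w, hw, hsrc, rfl⟩ | ⟨-, w, hw, hsrc, rfl⟩⟩
    · rw [hlab_old _ (H.edge_src e heH) hs, hlab_old _ (H.edge_tgt e heH) ht]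
      exact henc e heH hα
    · rw [hlabf _ (p.body.edge_src d hd), hlabf _ (p.body.edge_tgt d hd)]
      obtain ⟨h1, h2⟩ := (N1 d hd).1 hα
      revert h1 h2
      rcases p.body.lab d.1 with (_ | _) | _ <;> rcases p.body.lab d.2.2 with (_ | _) | _ <;>
        simp [isNodeL, isWireL]
    · rw [hlab_old w (H.edge_src _ hw) (H.no_loop _ hw), hsrc, hlabf _ hct]
      exact ⟨fun h => W3' c hc h hα, W2 c hc hct⟩
    · rw [hlab_old w (H.edge_tgt _ hw) (H.no_loop _ hw).symm, hsrc, hlabf _ hct]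
      exact ⟨W2 c hc hct, fun h => W3' c hc h hα⟩
  · intro x hx hxw
    rw [hverts, Finset.mem_union, Finset.mem_image] at hx
    rw [inDeg_le_one_iff, outDeg_le_one_iff]
    rcases hx with hx | ⟨y, hy, rfl⟩
    · obtain ⟨hxv, hxH⟩ := Finset.mem_erase.1 hx
      rw [hlab x hx] at hxw
      obtain ⟨hin, hout⟩ := hwire x hxH hxw
      rw [inDeg_le_one_iff] at hin
      rw [outDeg_le_one_iff] at hout
      have hne : ∀ y ∈ p.body.verts, f y ≠ x := fun y hy h => hfresh y hy (h ▸ hxH)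
      have key_in : ∀ e ∈ H'.edges, e.2.2 = x → (e ∈ H.edges ∧ e.1 ≠ v) ∨
          ∃ c ∈ p.conn, c.dirIn = false ∧ H.lab x = c.src ∧ (v, c.oldLab, x) ∈ H.edges ∧
            e = (f c.target, c.newLab, x) := by
        intro e he hex
        rcases (hedges e).1 he with ⟨heH, hs, -⟩ | ⟨d, hd, rfl⟩ |
          ⟨c, hc, hct, ⟨-, w, hw, hsrc, rfl⟩ | ⟨hdir, w, hw, hsrc, rfl⟩⟩
        · exact .inl ⟨heH, hs⟩
        · exact absurd hex (hne _ (p.body.edge_tgt d hd))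
        · exact absurd hex (hne _ hct)
        · obtain rfl : w = x := hex
          exact .inr ⟨c, hc, hdir, hsrc, hw, rfl⟩
      have key_out : ∀ e ∈ H'.edges, e.1 = x → (e ∈ H.edges ∧ e.2.2 ≠ v) ∨
          ∃ c ∈ p.conn, c.dirIn = true ∧ H.lab x = c.src ∧ (x, c.oldLab, v) ∈ H.edges ∧
            e = (x, c.newLab, f c.target) := by
        intro e he hex
        rcases (hedges e).1 he with ⟨heH, -, ht⟩ | ⟨d, hd, rfl⟩ |
          ⟨c, hc, hct, ⟨hdir, w, hw, hsrc, rfl⟩ | ⟨-, w, hw, hsrc, rfl⟩⟩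
        · exact .inl ⟨heH, ht⟩
        · exact absurd hex (hne _ (p.body.edge_src d hd))
        · obtain rfl : w = x := hex
          exact .inr ⟨c, hc, hdir, hsrc, hw, rfl⟩
        · exact absurd hex (hne _ hct)
      constructor
      · intro e he e' he' hex hex'
        rcases key_in e he hex with ⟨h, hv⟩ | ⟨c, hc, hd, hs, h, rfl⟩ <;>
          rcases key_in e' he' hex' with ⟨h', hv'⟩ | ⟨c', hc', hd', hs', h', rfl⟩
        · exact hin e h e' h' hex hex'
        · exact absurd (congrArg Prod.fst (hin e h _ h' hex rfl)) hv
        · exact absurd (congrArg Prod.fst (hin e' h' _ h hex' rfl)) hv'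
        · have hβ : c.oldLab = c'.oldLab :=
            congrArg (fun e => e.2.1) (hin _ h _ h' rfl rfl)
          rw [W3 c hc c' hc' (hs ▸ hxw) (hs.symm.trans hs') hβ (hd.trans hd'.symm)]
      · intro e he e' he' hex hex'
        rcases key_out e he hex with ⟨h, hv⟩ | ⟨c, hc, hd, hs, h, rfl⟩ <;>
          rcases key_out e' he' hex' with ⟨h', hv'⟩ | ⟨c', hc', hd', hs', h', rfl⟩
        · exact hout e h e' h' hex hex'
        · exact absurd (congrArg (fun e => e.2.2) (hout e h _ h' hex rfl)) hv
        · exact absurd (congrArg (fun e => e.2.2) (hout e' h' _ h hex' rfl)) hv'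
        · have hβ : c.oldLab = c'.oldLab :=
            congrArg (fun e => e.2.1) (hout _ h _ h' rfl rfl)
          rw [W3 c hc c' hc' (hs ▸ hxw) (hs.symm.trans hs') hβ (hd.trans hd'.symm)]
    · rw [hlabf y hy] at hxw
      obtain ⟨hin, hout⟩ := W1 y hy hxw
      rw [inDeg_le_one_iff] at hin
      rw [outDeg_le_one_iff] at hout
      have hne : ∀ w ∈ H.verts, w ≠ f y := fun w hw h => hfresh y hy (h ▸ hw)
      have hct_ne : ∀ c ∈ p.conn, c.target ∈ p.body.verts → f c.target ≠ f y := by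
        intro c hc hct h
        exact W2 c hc hct (hinj hct hy h ▸ hxw)
      have key : ∀ e ∈ H'.edges, e.1 = f y ∨ e.2.2 = f y →
          ∃ d ∈ p.body.edges, e = (f d.1, d.2.1, f d.2.2) := by
        intro e he hey
        rcases (hedges e).1 he with ⟨heH, -, -⟩ | hd |
          ⟨c, hc, hct, ⟨-, w, hw, -, rfl⟩ | ⟨-, w, hw, -, rfl⟩⟩
        · exact (hey.elim (hne _ (H.edge_src e heH)) (hne _ (H.edge_tgt e heH))).elim
        · exact hd
        · exact (hey.elim (hne w (H.edge_src _ hw)) (hct_ne c hc hct)).elim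
        · exact (hey.elim (hct_ne c hc hct) (hne w (H.edge_tgt _ hw))).elim
      constructor
      · intro e he e' he' hey hey'
        obtain ⟨d, hd, rfl⟩ := key e he (.inr hey)
        obtain ⟨d', hd', rfl⟩ := key e' he' (.inr hey')
        rw [hin d hd d' hd' (hinj (p.body.edge_tgt d hd) hy hey)
          (hinj (p.body.edge_tgt d' hd') hy hey')]
      · intro e he e' he' hey hey'
        obtain ⟨d, hd, rfl⟩ := key e he (.inl hey)
        obtain ⟨d', hd', rfl⟩ := key e' he' (.inl hey')
        rw [hout d hd d' hd' (hinj (p.body.edge_src d hd) hy hey)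
          (hinj (p.body.edge_src d' hd') hy hey')]

theorem IsESGForm.deriv {enc : Finset EL} {G : Grammar NL WL NT EL}
    (hG : ∀ p ∈ G.prods, CondsNW enc G p) {H H' : SG NL WL NT EL}
    (hH : IsESGForm enc H) (hd : Deriv G H H') : IsESGForm enc H' := by
  obtain ⟨steps, hd⟩ := hd
  induction hd with
  | refl => exact hH
  | step hs _ ih => exact ih (hH.stepWith hG hs)

/-- An ESG-form without non-terminals is an encoded string graph. -/
theorem IsESGForm.isEncodedSG {enc : Finset EL} {H : SG NL WL NT EL}
    (hH : IsESGForm enc H) (hnt : NoNT H) : IsEncodedSG enc H := by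
  have isNode : ∀ x ∈ H.verts, ¬ isWireL (H.lab x) → isNodeL (H.lab x) := by
    intro x hx hw
    have hn := hnt x hx
    revert hw hn
    rcases H.lab x with (_ | _) | _ <;> simp [isNodeL, isWireL, isNTL]
  refine ⟨hnt, fun e he => ⟨fun h => hH.1 e he h.1 h.2, fun h => ?_⟩, hH.2.2⟩
  obtain ⟨h1, h2⟩ := hH.2.1 e he h
  exact ⟨isNode _ (H.edge_src e he) h1, isNode _ (H.edge_tgt e he) h2⟩

theorem isESGForm_startGraph (enc : Finset EL) (S : NT) :
    IsESGForm enc (startGraph S : SG NL WL NT EL) := by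
  simp [IsESGForm, startGraph, isWireL]

/-- in a B-ESG grammar, applying any production to a
non-terminal of an ESG-form yields an ESG-form; hence any derivation from an
ESG-form eliminating all non-terminals produces an encoded string graph; in
particular every terminal graph derived from the initial graph `S` is an
encoded string graph. -/
theorem besg_esg_form_derivations
    {NL WL NT EL : Type} (B : BESG NL WL NT EL) (hB : IsBESG B) :
    (∀ (H H' : SG NL WL NT EL) (v i : ℕ) (f : ℕ → ℕ),
      IsESGForm B.enc H → StepWith B.G H v i f H' → IsESGForm B.enc H') ∧
    (∀ H H' : SG NL WL NT EL,
      IsESGForm B.enc H → Deriv B.G H H' → NoNT H' → IsEncodedSG B.enc H') ∧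
    (IsESGForm B.enc (startGraph B.G.start : SG NL WL NT EL) ∧
      ∀ H' : SG NL WL NT EL, Deriv B.G (startGraph B.G.start) H' → NoNT H' →
        IsEncodedSG B.enc H') := by
  have hstart : IsESGForm B.enc (startGraph B.G.start : SG NL WL NT EL) :=
    isESGForm_startGraph _ _
  exact ⟨fun H H' v i f hH hs => hH.stepWith hB.2 hs,
    fun H H' hH hd hnt => (hH.deriv hB.2 hd).isEncodedSG hnt,
    hstart, fun H' hd hnt => (hstart.deriv hB.2 hd).isEncodedSG hnt⟩

end BESG
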